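/- Fix θ ∈ (0,1) and q = Θ(n^{2(θ−1)}), let G ~ ER(n,q) with k̄ = q·C(n,2), and perform t i.i.d. Bernoulli(p) tests with p = √(2/(q n²)). If for some η > 0 one has t ≥ (1+η)·2·max{θ, 1−θ}·e·k̄·ln n for all n, then the DD decoder satisfies P[Ê_DD ≠ E(G)] → 0 as n → ∞. -/

import Mathlib

open scoped BigOperators Classical
open Finset Filter

noncomputable section

/-- The set of all potential edges: unordered pairs of distinct nodes of `Fin n`. -/
def allPairs (n : ℕ) : Finset (Sym2 (Fin n)) :=
  Finset.univ.filter fun e => ¬ e.IsDiag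

/-- Both endpoints of the pair `e` lie in the test `L`. -/
def pairIn {n : ℕ} (e : Sym2 (Fin n)) (L : Finset (Fin n)) : Prop :=
  ∀ v ∈ e, v ∈ L

/-- The test `L` covers some edge of the edge set `E` (positive outcome `Y = 1`). -/
def covers {n : ℕ} (E : Finset (Sym2 (Fin n))) (L : Finset (Fin n)) : Prop :=
  ∃ e ∈ E, pairIn e L

/-- ER(n,q) probability weight of a given edge set `E`. -/
def erWeight (n : ℕ) (q : ℝ) (E : Finset (Sym2 (Fin n))) : ℝ :=
  q ^ E.card * (1 - q) ^ ((allPairs n).card - E.card)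

/-- Probability of an event under the Erdős–Rényi random graph ER(n,q). -/
def erProb (n : ℕ) (q : ℝ) (A : Finset (Sym2 (Fin n)) → Prop) : ℝ :=
  ∑ E ∈ (allPairs n).powerset, if A E then erWeight n q E else 0

/-- Bernoulli(p) probability weight of a single test `L ⊆ {1,…,n}`. -/
def testWeight (n : ℕ) (p : ℝ) (L : Finset (Fin n)) : ℝ :=
  p ^ L.card * (1 - p) ^ (n - L.card)

/-- Probability of an event for a single Bernoulli(p) test. -/
def bernProb (n : ℕ) (p : ℝ) (A : Finset (Fin n) → Prop) : ℝ :=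
  ∑ L : Finset (Fin n), if A L then testWeight n p L else 0

/-- Probability weight of `t` i.i.d. Bernoulli(p) tests. -/
def testsWeight (n t : ℕ) (p : ℝ) (Ls : Fin t → Finset (Fin n)) : ℝ :=
  ∏ i, testWeight n p (Ls i)

/-- Probability of an event for `t` i.i.d. Bernoulli(p) tests. -/
def bernTestsProb (n t : ℕ) (p : ℝ) (A : (Fin t → Finset (Fin n)) → Prop) : ℝ :=
  ∑ Ls : Fin t → Finset (Fin n), if A Ls then testsWeight n t p Ls else 0

/-- Joint probability over an ER(n,q) graph and `t` i.i.d. Bernoulli(p) tests. -/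
def erTestsProb (n t : ℕ) (q p : ℝ)
    (A : Finset (Sym2 (Fin n)) → (Fin t → Finset (Fin n)) → Prop) : ℝ :=
  ∑ E ∈ (allPairs n).powerset, ∑ Ls : Fin t → Finset (Fin n),
    if A E Ls then erWeight n q E * testsWeight n t p Ls else 0

/-- Degree of node `v` in the edge set `E`. -/
def degOf {n : ℕ} (E : Finset (Sym2 (Fin n))) (v : Fin n) : ℕ :=
  (E.filter fun e => v ∈ e).card

/-- Maximum degree of the edge set `E`. -/
def maxDeg {n : ℕ} (E : Finset (Sym2 (Fin n))) : ℕ :=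
  Finset.univ.sup (degOf E)

/-- Average number of edges of ER(n, q n): `k̄ = q·C(n,2)`. -/
def kbar (q : ℕ → ℝ) (n : ℕ) : ℝ := q n * (n.choose 2 : ℝ)

/-- Two pairs are vertex-disjoint. -/
def sym2Disjoint {n : ℕ} (e e' : Sym2 (Fin n)) : Prop := ∀ v, v ∈ e → v ∉ e'

/-- The set of "possible edges": pairs not both contained in any negative test. -/
def peSet (n t : ℕ) (Ls : Fin t → Finset (Fin n)) (Y : Fin t → Prop) :
    Finset (Sym2 (Fin n)) :=
  (allPairs n).filter fun e => ¬ ∃ i, ¬ Y i ∧ pairIn e (Ls i)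

/-- The DD decoder: declare a possible edge to be an edge iff some test contains it and
covers no other possible edge. -/
def ddDecoder (n t : ℕ) (Ls : Fin t → Finset (Fin n)) (Y : Fin t → Prop) :
    Finset (Sym2 (Fin n)) :=
  (peSet n t Ls Y).filter fun e => ∃ i, pairIn e (Ls i) ∧
    ∀ e' ∈ peSet n t Ls Y, pairIn e' (Ls i) → e' = e


/-- Weight of `L` when each vertex `v` is included independently with probability `x v`. -/
def vertexWeight {n : ℕ} (x : Fin n → ℝ) (L : Finset (Fin n)) : ℝ :=
  ∏ v, if v ∈ L then x v else 1 - x v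

lemma testWeight_eq_vertexWeight (n : ℕ) (p : ℝ) (L : Finset (Fin n)) :
    testWeight n p L = vertexWeight (fun _ => p) L := by
  simp [testWeight, vertexWeight, Finset.prod_ite, Finset.filter_not, Finset.card_sdiff]

lemma vertexWeight_nonneg {n : ℕ} {x : Fin n → ℝ} (hx : ∀ v, 0 ≤ x v ∧ x v ≤ 1)
    (L : Finset (Fin n)) : 0 ≤ vertexWeight x L := by
  refine Finset.prod_nonneg fun v _ => ?_
  have := hx v
  split_ifs <;> linarith

lemma sum_vertexWeight {n : ℕ} (x : Fin n → ℝ) : ∑ L, vertexWeight x L = 1 := by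
  have h := Finset.prod_add x (fun v => 1 - x v) (Finset.univ : Finset (Fin n))
  simp only [add_sub_cancel, Finset.prod_const_one, Finset.powerset_univ] at h
  rw [h]
  refine Finset.sum_congr rfl fun L _ => ?_
  simp [vertexWeight, Finset.prod_ite, Finset.filter_not]

/-- Restricting to the sets containing `U` amounts to including `U` with certainty. -/
lemma vertexWeight_restrict {n : ℕ} (x : Fin n → ℝ) (U L : Finset (Fin n)) :
    (if U ⊆ L then vertexWeight x L else 0) =
      (∏ v ∈ U, x v) * vertexWeight (fun v => if v ∈ U then 1 else x v) L := by
  have hU : ∏ v ∈ U, x v = ∏ v, if v ∈ U then x v else 1 := by simp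
  rw [hU, vertexWeight, vertexWeight, ← Finset.prod_mul_distrib]
  split_ifs with h
  · refine Finset.prod_congr rfl fun v _ => ?_
    by_cases hv : v ∈ U
    · simp [hv, h hv]
    · simp [hv]
  · obtain ⟨v, hvU, hvL⟩ := Finset.not_subset.mp h
    exact (Finset.prod_eq_zero (Finset.mem_univ v) (by simp [hvU, hvL])).symm

lemma sum_vertexWeight_superset {n : ℕ} (x : Fin n → ℝ) (U : Finset (Fin n)) :
    (∑ L, if U ⊆ L then vertexWeight x L else 0) = ∏ v ∈ U, x v := by
  simp_rw [vertexWeight_restrict]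
  rw [← Finset.mul_sum, sum_vertexWeight, mul_one]

lemma vertexWeight_mul_le {n : ℕ} (x : Fin n → ℝ) (A B : Finset (Fin n)) :
    vertexWeight x A * vertexWeight x B ≤ vertexWeight x (A ∩ B) * vertexWeight x (A ∪ B) := by
  simp only [vertexWeight, ← Finset.prod_mul_distrib]
  refine le_of_eq (Finset.prod_congr rfl fun v _ => ?_)
  by_cases hA : v ∈ A <;> by_cases hB : v ∈ B <;> simp [hA, hB, mul_comm]

lemma pairIn_iff_toFinset_subset {n : ℕ} (e : Sym2 (Fin n)) (L : Finset (Fin n)) :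
    pairIn e L ↔ e.toFinset ⊆ L := by
  simp [pairIn, Finset.subset_iff]

lemma pairIn.mono {n : ℕ} {e : Sym2 (Fin n)} {L L' : Finset (Fin n)} (h : pairIn e L)
    (hL : L ⊆ L') : pairIn e L' := fun v hv => hL (h v hv)

/-- Harris inequality: avoiding all the pairs of `T` is at least as likely as if these events were
independent. -/
lemma prod_le_sum_vertexWeight_not_covers {n : ℕ} {x : Fin n → ℝ}
    (hx : ∀ v, 0 ≤ x v ∧ x v ≤ 1) (T : Finset (Sym2 (Fin n))) :
    ∏ e ∈ T, (1 - ∏ v ∈ e.toFinset, x v) ≤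
      ∑ L, if covers T L then 0 else vertexWeight x L := by
  induction T using Finset.induction_on with
  | empty => simp [covers, sum_vertexWeight]
  | insert e T he ih =>
    have key := fkg (α := (Finset (Fin n))ᵒᵈ)
      (μ := fun L => vertexWeight x (OrderDual.ofDual L))
      (f := fun L => if pairIn e (OrderDual.ofDual L) then (0 : ℝ) else 1)
      (g := fun L => if covers T (OrderDual.ofDual L) then (0 : ℝ) else 1)
      (fun L => vertexWeight_nonneg hx _)
      (fun L => by dsimp only [Pi.zero_apply]; split_ifs <;> norm_num)
      (fun L => by dsimp only [Pi.zero_apply]; split_ifs <;> norm_num)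
      (fun A B hAB => by
        have hBA : OrderDual.ofDual B ⊆ OrderDual.ofDual A := hAB
        dsimp only
        split_ifs with h1 h2 h2 <;> try norm_num
        exact absurd (h2.mono hBA) h1)
      (fun A B hAB => by
        have hBA : OrderDual.ofDual B ⊆ OrderDual.ofDual A := hAB
        dsimp only
        split_ifs with h1 h2 h2 <;> try norm_num
        obtain ⟨e', he', h⟩ := h2
        exact absurd ⟨e', he', h.mono hBA⟩ h1)
      (fun A B => by
        rw [mul_comm (vertexWeight x _) (vertexWeight x (OrderDual.ofDual (A ⊔ B)))]
        exact vertexWeight_mul_le x _ _)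
    have hsum : ∀ f : Finset (Fin n) → ℝ,
        ∑ L : (Finset (Fin n))ᵒᵈ, f (OrderDual.ofDual L) = ∑ L, f L :=
      fun f => Equiv.sum_comp OrderDual.ofDual f
    rw [hsum (fun L => vertexWeight x L * if pairIn e L then (0 : ℝ) else 1),
      hsum (fun L => vertexWeight x L * if covers T L then (0 : ℝ) else 1),
      hsum (vertexWeight x), sum_vertexWeight, one_mul,
      hsum (fun L => vertexWeight x L *
        ((if pairIn e L then (0 : ℝ) else 1) * if covers T L then (0 : ℝ) else 1))] at key
    have h1 : ∑ L, (vertexWeight x L * if pairIn e L then (0 : ℝ) else 1) =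
        1 - ∏ v ∈ e.toFinset, x v := by
      rw [← sum_vertexWeight_superset x, eq_sub_iff_add_eq, ← Finset.sum_add_distrib]
      refine (Finset.sum_congr rfl fun L _ => ?_).trans (sum_vertexWeight x)
      by_cases hL : e.toFinset ⊆ L <;> simp [pairIn_iff_toFinset_subset, hL]
    have h2 : ∑ L, (vertexWeight x L * if covers T L then (0 : ℝ) else 1) =
        ∑ L, if covers T L then 0 else vertexWeight x L := by simp
    have h3 : ∑ L, (vertexWeight x L *
        ((if pairIn e L then (0 : ℝ) else 1) * if covers T L then (0 : ℝ) else 1)) =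
        ∑ L, if covers (insert e T) L then 0 else vertexWeight x L := by
      refine Finset.sum_congr rfl fun L _ => ?_
      have : covers (insert e T) L ↔ pairIn e L ∨ covers T L := by simp [covers]
      by_cases hp : pairIn e L <;> by_cases hc : covers T L <;> simp [this, hp, hc]
    rw [h1, h2, h3] at key
    rw [Finset.prod_insert he]
    refine le_trans (mul_le_mul_of_nonneg_left ih ?_) key
    rw [sub_nonneg]
    exact Finset.prod_le_one (fun v _ => (hx v).1) fun v _ => (hx v).2

lemma card_allPairs_filter_mem_le {n : ℕ} (v : Fin n) :
    ((allPairs n).filter fun e => v ∈ e).card ≤ n := by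
  have h : ((allPairs n).filter fun e => v ∈ e) ⊆ Finset.univ.image fun u => s(v, u) := by
    intro e he
    obtain ⟨u, rfl⟩ := (Finset.mem_filter.mp he).2
    exact Finset.mem_image_of_mem _ (Finset.mem_univ u)
  simpa using (Finset.card_le_card h).trans Finset.card_image_le

/-- A pair `e` is the only pair of `S` inside `L`. -/
def isolates {n : ℕ} (S : Finset (Sym2 (Fin n))) (e : Sym2 (Fin n)) (L : Finset (Fin n)) : Prop :=
  pairIn e L ∧ ∀ e' ∈ S, pairIn e' L → e' = e

/-- Lower bound for the probability of isolating a pair in a set of at most `M` pairs with maximum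
degree at most `d`. -/
def isolationBound (p : ℝ) (d M : ℕ) : ℝ := p ^ 2 * ((1 - p) ^ (2 * d) * (1 - p ^ 2) ^ M)

lemma isolationBound_nonneg {p : ℝ} (hp0 : 0 ≤ p) (hp1 : p ≤ 1) (d M : ℕ) :
    0 ≤ isolationBound p d M := by
  have h1 : 0 ≤ 1 - p := by linarith
  have h2 : 0 ≤ 1 - p ^ 2 := by nlinarith
  unfold isolationBound
  positivity

lemma isolationBound_le_bernProb_isolates {n : ℕ} {p : ℝ} (hp0 : 0 ≤ p) (hp1 : p ≤ 1)
    {S : Finset (Sym2 (Fin n))} (hS : S ⊆ allPairs n) {e : Sym2 (Fin n)} (he : e ∈ allPairs n)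
    {d M : ℕ} (hd : ∀ v, degOf S v ≤ d) (hM : S.card ≤ M) :
    isolationBound p d M ≤ bernProb n p (isolates S e) := by
  have hpp : p ^ 2 ≤ p := by nlinarith
  set x : Fin n → ℝ := fun v => if v ∈ e.toFinset then 1 else p with hxdef
  have hx : ∀ v, 0 ≤ x v ∧ x v ≤ 1 := by
    intro v
    simp only [hxdef]
    split_ifs <;> constructor <;> linarith
  have hnd : ∀ {f : Sym2 (Fin n)}, f ∈ allPairs n → ¬ f.IsDiag := fun hf =>
    (Finset.mem_filter.mp hf).2
  have hprob : bernProb n p (isolates S e) =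
      p ^ 2 * ∑ L, if covers (S.erase e) L then 0 else vertexWeight x L := by
    have hcard : ∏ _v ∈ e.toFinset, p = p ^ 2 := by
      rw [Finset.prod_const, Sym2.card_toFinset_of_not_isDiag e (hnd he)]
    rw [bernProb, Finset.mul_sum]
    refine Finset.sum_congr rfl fun L _ => ?_
    have hw := vertexWeight_restrict (fun _ => p) e.toFinset L
    rw [hcard, ← testWeight_eq_vertexWeight] at hw
    simp only [← pairIn_iff_toFinset_subset] at hw
    have hiff : isolates S e L ↔ pairIn e L ∧ ¬ covers (S.erase e) L := by
      simp only [isolates, covers, Finset.mem_erase, not_exists, not_and, and_congr_right_iff]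
      intro _
      exact forall_congr' fun e' => by tauto
    by_cases hc : covers (S.erase e) L
    · simp [hiff, hc]
    · simpa [hiff, hc, hxdef] using hw
  rw [hprob, isolationBound]
  refine mul_le_mul_of_nonneg_left ?_ (sq_nonneg p)
  refine le_trans ?_ (prod_le_sum_vertexWeight_not_covers hx (S.erase e))
  set touching := (S.erase e).filter fun f => ∃ v ∈ e, v ∈ f with htouch
  set avoiding := (S.erase e).filter fun f => ¬ ∃ v ∈ e, v ∈ f with havoid
  rw [← Finset.prod_filter_mul_prod_filter_not (S.erase e) (fun f => ∃ v ∈ e, v ∈ f)]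
  have h1p : 0 ≤ 1 - p := by linarith
  have h1pp : 0 ≤ 1 - p ^ 2 := by nlinarith
  have htc : touching.card ≤ 2 * d := by
    obtain ⟨a, b, rfl⟩ : ∃ a b, e = s(a, b) := e.ind (fun a b => ⟨a, b, rfl⟩)
    have hsub : touching ⊆ (S.filter fun f => a ∈ f) ∪ (S.filter fun f => b ∈ f) := by
      intro f hf
      simp only [htouch, Finset.mem_filter, Finset.mem_erase, Sym2.mem_iff] at hf
      obtain ⟨⟨-, hfS⟩, v, rfl | rfl, hv⟩ := hf <;> simp [hfS, hv]
    have h1 := (Finset.card_le_card hsub).trans (Finset.card_union_le _ _)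
    have ha := hd a
    have hb := hd b
    unfold degOf at ha hb
    omega
  have hac : avoiding.card ≤ M :=
    (Finset.card_le_card ((Finset.filter_subset _ _).trans (Finset.erase_subset _ _))).trans hM
  refine mul_le_mul ?_ ?_ (by positivity) ?_
  · refine (pow_le_pow_of_le_one h1p (by linarith) htc).trans ?_
    rw [← Finset.prod_const]
    refine Finset.prod_le_prod (fun _ _ => h1p) fun f hf => ?_
    obtain ⟨hfe, hfS⟩ := Finset.mem_erase.mp (Finset.mem_filter.mp hf).1
    obtain ⟨w, hwf, hwe⟩ : ∃ w ∈ f.toFinset, w ∉ e.toFinset := by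
      by_contra! hsub
      have heq : f.toFinset = e.toFinset := Finset.eq_of_subset_of_card_le hsub (by
        rw [Sym2.card_toFinset_of_not_isDiag e (hnd he),
          Sym2.card_toFinset_of_not_isDiag f (hnd (hS hfS))])
      exact hfe (Sym2.ext fun v => by rw [← Sym2.mem_toFinset, heq, Sym2.mem_toFinset])
    rw [← Finset.mul_prod_erase _ _ hwf]
    have hrest : ∏ v ∈ f.toFinset.erase w, x v ≤ 1 :=
      Finset.prod_le_one (fun v _ => (hx v).1) fun v _ => (hx v).2
    have hxw : x w = p := by simp only [hxdef, if_neg hwe]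
    rw [hxw]
    nlinarith
  · refine (pow_le_pow_of_le_one h1pp (by nlinarith) hac).trans ?_
    rw [← Finset.prod_const]
    refine Finset.prod_le_prod (fun _ _ => h1pp) fun f hf => ?_
    obtain ⟨hfS, hfe⟩ := Finset.mem_filter.mp hf
    have hf2 := Sym2.card_toFinset_of_not_isDiag f (hnd (hS (Finset.mem_of_mem_erase hfS)))
    rw [Finset.prod_congr rfl (g := fun _ => p), Finset.prod_const, hf2]
    intro v hv
    simp only [hxdef]
    rw [if_neg]
    exact fun hve => hfe ⟨v, Sym2.mem_toFinset.mp hve, Sym2.mem_toFinset.mp hv⟩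
  · refine Finset.prod_nonneg fun f _ => ?_
    rw [sub_nonneg]
    exact Finset.prod_le_one (fun v _ => (hx v).1) fun v _ => (hx v).2

lemma testWeight_nonneg {p : ℝ} (hp0 : 0 ≤ p) (hp1 : p ≤ 1) (n : ℕ) (L : Finset (Fin n)) :
    0 ≤ testWeight n p L := by
  rw [testWeight_eq_vertexWeight]
  exact vertexWeight_nonneg (fun _ => ⟨hp0, hp1⟩) L

lemma sum_testWeight (n : ℕ) (p : ℝ) : ∑ L, testWeight n p L = 1 := by
  simp_rw [testWeight_eq_vertexWeight]
  exact sum_vertexWeight _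

lemma testsWeight_nonneg {p : ℝ} (hp0 : 0 ≤ p) (hp1 : p ≤ 1) (n t : ℕ)
    (Ls : Fin t → Finset (Fin n)) : 0 ≤ testsWeight n t p Ls :=
  Finset.prod_nonneg fun _ _ => testWeight_nonneg hp0 hp1 n _

lemma sum_testsWeight (n t : ℕ) (p : ℝ) : ∑ Ls, testsWeight n t p Ls = 1 := by
  have h := Finset.prod_univ_sum (fun _ : Fin t => (Finset.univ : Finset (Finset (Fin n))))
    (fun _ L => testWeight n p L)
  simpa [sum_testWeight, testsWeight] using h.symm

lemma bernProb_mono {n : ℕ} {p : ℝ} (hp0 : 0 ≤ p) (hp1 : p ≤ 1)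
    {A B : Finset (Fin n) → Prop} (h : ∀ L, A L → B L) : bernProb n p A ≤ bernProb n p B := by
  refine Finset.sum_le_sum fun L _ => ?_
  have := testWeight_nonneg hp0 hp1 n L
  by_cases hA : A L
  · simp [hA, h L hA]
  · by_cases hB : B L <;> simp [hA, hB, this]

lemma bernProb_not (n : ℕ) (p : ℝ) (A : Finset (Fin n) → Prop) :
    bernProb n p (fun L => ¬ A L) = 1 - bernProb n p A := by
  rw [← sum_testWeight n p, bernProb, bernProb, ← Finset.sum_sub_distrib]
  refine Finset.sum_congr rfl fun L _ => ?_
  by_cases h : A L <;> simp [h]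

lemma bernProb_nonneg {n : ℕ} {p : ℝ} (hp0 : 0 ≤ p) (hp1 : p ≤ 1)
    (A : Finset (Fin n) → Prop) : 0 ≤ bernProb n p A :=
  Finset.sum_nonneg fun L _ => by
    have := testWeight_nonneg hp0 hp1 n L
    split_ifs <;> simp [this]

lemma bernTestsProb_mono {n t : ℕ} {p : ℝ} (hp0 : 0 ≤ p) (hp1 : p ≤ 1)
    {A B : (Fin t → Finset (Fin n)) → Prop} (h : ∀ Ls, A Ls → B Ls) :
    bernTestsProb n t p A ≤ bernTestsProb n t p B := by
  refine Finset.sum_le_sum fun L _ => ?_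
  have := testsWeight_nonneg hp0 hp1 n t L
  by_cases hA : A L
  · simp [hA, h L hA]
  · by_cases hB : B L <;> simp [hA, hB, this]

lemma bernTestsProb_or_le {n t : ℕ} {p : ℝ} (hp0 : 0 ≤ p) (hp1 : p ≤ 1)
    (A B : (Fin t → Finset (Fin n)) → Prop) :
    bernTestsProb n t p (fun Ls => A Ls ∨ B Ls) ≤
      bernTestsProb n t p A + bernTestsProb n t p B := by
  rw [bernTestsProb, bernTestsProb, bernTestsProb, ← Finset.sum_add_distrib]
  refine Finset.sum_le_sum fun L _ => ?_
  have := testsWeight_nonneg hp0 hp1 n t L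
  by_cases hA : A L <;> by_cases hB : B L <;> simp [hA, hB, this]

/-- Markov's inequality for the size of a random subset `N Ls` of `s`. -/
lemma bernTestsProb_le_card_mul_le {n t : ℕ} {p : ℝ} (hp0 : 0 ≤ p) (hp1 : p ≤ 1) {ι : Type*}
    (s : Finset ι) (N : (Fin t → Finset (Fin n)) → Finset ι) (hN : ∀ Ls, N Ls ⊆ s) (K : ℕ) :
    bernTestsProb n t p (fun Ls => K ≤ (N Ls).card) * K ≤
      ∑ a ∈ s, bernTestsProb n t p (fun Ls => a ∈ N Ls) := by
  simp only [bernTestsProb]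
  rw [Finset.sum_comm, Finset.sum_mul]
  refine Finset.sum_le_sum fun Ls _ => ?_
  have hw := testsWeight_nonneg hp0 hp1 n t Ls
  refine le_trans ?_ (Finset.sum_le_sum_of_subset_of_nonneg (hN Ls) fun a _ ha =>
    (if_neg ha).ge)
  refine le_trans ?_ (Finset.card_nsmul_le_sum (N Ls) _ (testsWeight n t p Ls) fun a ha =>
    (if_pos ha).ge)
  rw [nsmul_eq_mul]
  split_ifs with h
  · rw [mul_comm]
    exact mul_le_mul_of_nonneg_right (by exact_mod_cast h) hw
  · rw [zero_mul]
    positivity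

lemma bernTestsProb_exists_le {n t : ℕ} {p : ℝ} (hp0 : 0 ≤ p) (hp1 : p ≤ 1) {ι : Type*}
    (s : Finset ι) (A : ι → (Fin t → Finset (Fin n)) → Prop) :
    bernTestsProb n t p (fun Ls => ∃ a ∈ s, A a Ls) ≤ ∑ a ∈ s, bernTestsProb n t p (A a) := by
  have h := bernTestsProb_le_card_mul_le hp0 hp1 s (fun Ls => s.filter fun a => A a Ls)
    (fun _ => Finset.filter_subset _ _) 1
  rw [Nat.cast_one, mul_one] at h
  refine le_trans (bernTestsProb_mono hp0 hp1 fun Ls hLs => ?_) (h.trans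
    (Finset.sum_le_sum fun a _ => bernTestsProb_mono hp0 hp1 fun Ls hLs =>
      (Finset.mem_filter.mp hLs).2))
  obtain ⟨a, ha, hA⟩ := hLs
  exact Finset.card_pos.mpr ⟨a, by simp [ha, hA]⟩

lemma one_sub_pow_le_exp {r : ℝ} (hr : r ≤ 1) (t : ℕ) : (1 - r) ^ t ≤ Real.exp (-(r * t)) := by
  have h : 1 - r ≤ Real.exp (-r) := by linarith [Real.add_one_le_exp (-r)]
  refine (pow_le_pow_left₀ (by linarith) h t).trans_eq ?_
  rw [← Real.exp_nat_mul]
  congr 1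
  ring

lemma bernTestsProb_forall (n t : ℕ) (p : ℝ) (A : Finset (Fin n) → Prop) :
    bernTestsProb n t p (fun Ls => ∀ i, A (Ls i)) = bernProb n p A ^ t := by
  have h := Finset.prod_univ_sum (fun _ : Fin t => (Finset.univ : Finset (Finset (Fin n))))
    (fun _ L => if A L then testWeight n p L else 0)
  simp only [Finset.prod_const, Finset.card_univ, Fintype.card_fin, Fintype.piFinset_univ] at h
  rw [bernProb, h, bernTestsProb]
  refine Finset.sum_congr rfl fun Ls _ => ?_
  rw [Finset.prod_ite_zero]
  simp [testsWeight]

lemma bernTestsProb_forall_not_le {n t : ℕ} {p : ℝ} (hp0 : 0 ≤ p) (hp1 : p ≤ 1)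
    {A : Finset (Fin n) → Prop} {r : ℝ} (hr : r ≤ bernProb n p A) :
    bernTestsProb n t p (fun Ls => ∀ i, ¬ A (Ls i)) ≤ Real.exp (-(r * t)) := by
  have h0 := bernProb_nonneg hp0 hp1 (fun L => ¬ A L)
  have h1 := bernProb_not n p A
  rw [bernTestsProb_forall n t p (fun L => ¬ A L), h1]
  refine (pow_le_pow_left₀ (h1 ▸ h0) (sub_le_sub_left hr 1) t).trans (one_sub_pow_le_exp ?_ t)
  linarith

/-- Tests satisfying `A` are independent of the other tests; hence if the target event `B Ls`, of
probability at least `r`, implies `A` and is determined by the tests not satisfying `A`, the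
probability that no test hits the target is at most `exp (-r t)`. -/
lemma bernTestsProb_no_hit_le {n t : ℕ} {p : ℝ} (hp0 : 0 ≤ p) (hp1 : p ≤ 1)
    {A : Finset (Fin n) → Prop} {a₀ : Finset (Fin n)} (ha₀ : A a₀)
    {B : (Fin t → Finset (Fin n)) → Finset (Fin n) → Prop} (hBA : ∀ Ls L, B Ls L → A L)
    (hB : ∀ Ls, B Ls = B (fun i => if A (Ls i) then a₀ else Ls i)) (r : ℝ) :
    bernTestsProb n t p (fun Ls => r ≤ bernProb n p (B Ls) ∧ ∀ i, ¬ B Ls (Ls i)) ≤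
      Real.exp (-(r * t)) := by
  set φ : Finset (Fin n) → Finset (Fin n) := fun L => if A L then a₀ else L with hφ
  have hφa : ∀ L, φ L = a₀ ↔ A L := by
    intro L
    by_cases hL : A L
    · simp [hφ, hL]
    · simp only [hφ, hL, if_false, iff_false]
      rintro rfl
      exact hL ha₀
  have hw := testWeight_nonneg hp0 hp1 n
  have hA1 : bernProb n p A ≤ 1 := by
    linarith [bernProb_not n p A, bernProb_nonneg hp0 hp1 (fun L => ¬ A L)]
  by_cases hrA : r ≤ bernProb n p A
  swap
  · rw [bernTestsProb, Finset.sum_eq_zero]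
    · positivity
    · intro Ls _
      rw [if_neg]
      exact fun h => hrA (h.1.trans (bernProb_mono hp0 hp1 (hBA Ls)))
  set g : Finset (Fin n) → ℝ := fun x =>
    (∑ L with φ L = x, testWeight n p L) - if x = a₀ then r else 0 with hg
  have hAsum : ∑ L with φ L = a₀, testWeight n p L = bernProb n p A := by
    rw [bernProb, Finset.sum_filter]
    exact Finset.sum_congr rfl fun L _ => by simp only [hφa]
  have hg0 : ∀ x, 0 ≤ g x := by
    intro x
    by_cases hx : x = a₀
    · subst hx
      simp only [hg, if_true, hAsum]
      linarith
    · simp only [hg, hx, if_false, sub_zero]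
      exact Finset.sum_nonneg fun L _ => hw L
  have hgsum : ∑ x, g x = 1 - r := by
    simp only [hg, Finset.sum_sub_distrib, Finset.sum_ite_eq', Finset.mem_univ, if_true]
    rw [Finset.sum_fiberwise, sum_testWeight]
  have hfiber : ∀ K : Fin t → Finset (Fin n),
      (∑ Ls with (fun i => φ (Ls i)) = K,
        if r ≤ bernProb n p (B Ls) ∧ ∀ i, ¬ B Ls (Ls i) then testsWeight n t p Ls else 0) ≤
      ∏ i, g (K i) := by
    intro K
    by_cases hK : r ≤ bernProb n p (B K)
    swap
    · rw [Finset.sum_eq_zero]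
      · exact Finset.prod_nonneg fun i _ => hg0 _
      · intro Ls hLs
        rw [if_neg]
        rintro ⟨h, -⟩
        rw [hB Ls, (Finset.mem_filter.mp hLs).2] at h
        exact hK h
    have hpi := Finset.prod_univ_sum
      (fun i : Fin t => Finset.univ.filter fun L => φ L = K i ∧ ¬ B K L)
      (fun _ L => testWeight n p L)
    have hLHS : (∑ Ls with (fun i => φ (Ls i)) = K,
        if r ≤ bernProb n p (B Ls) ∧ ∀ i, ¬ B Ls (Ls i) then testsWeight n t p Ls else 0) =
        ∏ i, ∑ L with φ L = K i ∧ ¬ B K L, testWeight n p L := by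
      rw [hpi, ← Finset.sum_filter, Finset.filter_filter]
      refine Finset.sum_congr ?_ fun _ _ => rfl
      ext Ls
      simp only [Finset.mem_filter, Finset.mem_univ, true_and, Fintype.mem_piFinset]
      constructor
      · rintro ⟨hφK, -, hnot⟩ i
        rw [hB Ls, hφK] at hnot
        exact ⟨congrFun hφK i, hnot i⟩
      · intro h
        have hφK : (fun i => φ (Ls i)) = K := funext fun i => (h i).1
        rw [hB Ls, hφK]
        exact ⟨rfl, hK, fun i => (h i).2⟩
    rw [hLHS]
    refine Finset.prod_le_prod (fun i _ => Finset.sum_nonneg fun L _ => hw L) fun i _ => ?_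
    have hsplit : (∑ L with φ L = K i ∧ ¬ B K L, testWeight n p L) +
        ∑ L with φ L = K i ∧ B K L, testWeight n p L = ∑ L with φ L = K i, testWeight n p L := by
      rw [← Finset.sum_filter_add_sum_filter_not (Finset.univ.filter fun L => φ L = K i) (B K),
        Finset.filter_filter, Finset.filter_filter, add_comm]
    by_cases hx : K i = a₀
    · have hBsum : ∑ L with φ L = K i ∧ B K L, testWeight n p L = bernProb n p (B K) := by
        rw [bernProb, ← Finset.sum_filter]
        refine Finset.sum_congr (Finset.filter_congr fun L _ => ?_) fun _ _ => rfl
        rw [hx, hφa]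
        exact ⟨fun h => h.2, fun h => ⟨hBA K L h, h⟩⟩
      simp only [hg, hx, if_true] at hsplit hBsum ⊢
      linarith
    · have : 0 ≤ ∑ L with φ L = K i ∧ B K L, testWeight n p L :=
        Finset.sum_nonneg fun L _ => hw L
      simp only [hg, hx, if_false]
      linarith
  calc bernTestsProb n t p (fun Ls => r ≤ bernProb n p (B Ls) ∧ ∀ i, ¬ B Ls (Ls i))
      = ∑ K : Fin t → Finset (Fin n), ∑ Ls with (fun i => φ (Ls i)) = K,
        if r ≤ bernProb n p (B Ls) ∧ ∀ i, ¬ B Ls (Ls i) then testsWeight n t p Ls else 0 := by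
        rw [bernTestsProb, Finset.sum_fiberwise]
        exact Finset.sum_congr rfl fun Ls _ => by congr
    _ ≤ ∑ K : Fin t → Finset (Fin n), ∏ i, g (K i) := Finset.sum_le_sum fun K _ => hfiber K
    _ = (1 - r) ^ t := by
        have h := Finset.prod_univ_sum
          (fun _ : Fin t => (Finset.univ : Finset (Finset (Fin n)))) (fun _ L => g L)
        rw [Fintype.piFinset_univ] at h
        rw [← h, hgsum]
        simp
    _ ≤ _ := one_sub_pow_le_exp (hrA.trans hA1) t

lemma card_allPairs (n : ℕ) : (allPairs n).card = n.choose 2 := by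
  have h := Sym2.card_subtype_not_diag (α := Fin n)
  rw [Fintype.card_fin, Fintype.card_subtype] at h
  rw [← h, allPairs]

/-- The possible edges given the outcomes of the tests `Ls` on the graph `E`. -/
def possibleEdges {n t : ℕ} (E : Finset (Sym2 (Fin n))) (Ls : Fin t → Finset (Fin n)) :
    Finset (Sym2 (Fin n)) :=
  peSet n t Ls fun i => covers E (Ls i)

lemma mem_possibleEdges {n t : ℕ} {E : Finset (Sym2 (Fin n))} {Ls : Fin t → Finset (Fin n)}
    {e : Sym2 (Fin n)} :
    e ∈ possibleEdges E Ls ↔ e ∈ allPairs n ∧ ∀ i, pairIn e (Ls i) → covers E (Ls i) := by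
  simp only [possibleEdges, peSet, Finset.mem_filter, not_exists, not_and, and_congr_right_iff]
  exact fun _ => forall_congr' fun i => by tauto

lemma subset_possibleEdges {n t : ℕ} {E : Finset (Sym2 (Fin n))} (hE : E ⊆ allPairs n)
    (Ls : Fin t → Finset (Fin n)) : E ⊆ possibleEdges E Ls := fun e he =>
  mem_possibleEdges.mpr ⟨hE he, fun _ hi => ⟨e, he, hi⟩⟩

lemma ddDecoder_eq_of_isolates {n t : ℕ} {E : Finset (Sym2 (Fin n))} (hE : E ⊆ allPairs n)
    {Ls : Fin t → Finset (Fin n)} (h : ∀ e ∈ E, ∃ i, isolates (possibleEdges E Ls) e (Ls i)) :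
    ddDecoder n t Ls (fun i => covers E (Ls i)) = E := by
  ext e
  simp only [ddDecoder, Finset.mem_filter]
  constructor
  · rintro ⟨he, i, hei, honly⟩
    obtain ⟨e', he', hi'⟩ := (mem_possibleEdges.mp he).2 i hei
    exact honly e' (subset_possibleEdges hE Ls he') hi' ▸ he'
  · exact fun he => ⟨subset_possibleEdges hE Ls he, h e he⟩

/-- A set `F` of non-edges consists of possible edges with exponentially small probability. -/
lemma bernTestsProb_subset_possibleEdges_le {n t : ℕ} {p : ℝ} (hp0 : 0 ≤ p) (hp1 : p ≤ 1)
    {E F : Finset (Sym2 (Fin n))} (hE : E ⊆ allPairs n) (hF : F ⊆ allPairs n \ E)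
    {d M : ℕ} (hd : ∀ v, degOf (E ∪ F) v ≤ d) (hM : (E ∪ F).card ≤ M) :
    bernTestsProb n t p (fun Ls => F ⊆ possibleEdges E Ls) ≤
      Real.exp (-(F.card * isolationBound p d M * t)) := by
  have hFP : F ⊆ allPairs n := hF.trans Finset.sdiff_subset
  set A : Finset (Fin n) → Prop := fun L => ∃ f ∈ F, isolates (E ∪ F) f L with hA
  have hprob : F.card * isolationBound p d M ≤ bernProb n p A := by
    calc F.card * isolationBound p d M = ∑ _f ∈ F, isolationBound p d M := by simp
      _ ≤ ∑ f ∈ F, bernProb n p (isolates (E ∪ F) f) := Finset.sum_le_sum fun f hf =>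
        isolationBound_le_bernProb_isolates hp0 hp1 (Finset.union_subset hE hFP) (hFP hf) hd hM
      _ ≤ bernProb n p A := by
        simp only [bernProb]
        rw [Finset.sum_comm]
        refine Finset.sum_le_sum fun L _ => ?_
        rw [← Finset.sum_filter, Finset.sum_const, nsmul_eq_mul]
        have hw := testWeight_nonneg hp0 hp1 n L
        by_cases hL : A L
        · rw [if_pos hL]
          refine mul_le_of_le_one_left hw ?_
          have : (F.filter fun f => isolates (E ∪ F) f L).card ≤ 1 := by
            refine Finset.card_le_one.mpr fun a ha b hb => ?_
            rw [Finset.mem_filter] at ha hb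
            exact hb.2.2 a (Finset.mem_union_right _ ha.1) ha.2.1
          exact_mod_cast this
        · have : (F.filter fun f => isolates (E ∪ F) f L) = ∅ :=
            Finset.filter_eq_empty_iff.mpr fun f hf h => hL ⟨f, hf, h⟩
          simp [this, hL]
  refine le_trans (bernTestsProb_mono hp0 hp1 fun Ls hLs i => ?_)
    (bernTestsProb_forall_not_le hp0 hp1 hprob)
  rintro ⟨f, hf, hfi, honly⟩
  obtain ⟨e, he, hei⟩ := (mem_possibleEdges.mp (hLs hf)).2 i hfi
  have hef := honly e (Finset.mem_union_left _ he) hei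
  exact (Finset.mem_sdiff.mp (hF hf)).2 (hef ▸ he)

lemma degOf_union_le {n : ℕ} (S T : Finset (Sym2 (Fin n))) (v : Fin n) :
    degOf (S ∪ T) v ≤ degOf S v + degOf T v := by
  rw [degOf, Finset.filter_union]
  exact Finset.card_union_le _ _

/-- An edge `e` of `E` whose isolation among the possible edges is likely is missed with
exponentially small probability. -/
lemma bernTestsProb_not_isolates_le {n t : ℕ} {p : ℝ} (hp0 : 0 ≤ p) (hp1 : p ≤ 1)
    {E : Finset (Sym2 (Fin n))} {e : Sym2 (Fin n)} (he : e ∈ E) (r : ℝ) :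
    bernTestsProb n t p (fun Ls => r ≤ bernProb n p (isolates (possibleEdges E Ls) e) ∧
      ∀ i, ¬ isolates (possibleEdges E Ls) e (Ls i)) ≤ Real.exp (-(r * t)) := by
  have huniv : pairIn e Finset.univ := fun v _ => Finset.mem_univ v
  refine bernTestsProb_no_hit_le hp0 hp1 (A := pairIn e) huniv
    (B := fun Ls => isolates (possibleEdges E Ls) e) (fun _ _ h => h.1) (fun Ls => ?_) r
  have : possibleEdges E Ls =
      possibleEdges E (fun i => if pairIn e (Ls i) then Finset.univ else Ls i) := by
    ext f
    simp only [mem_possibleEdges, and_congr_right_iff]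
    refine fun _ => forall_congr' fun i => ?_
    split_ifs with h
    · exact ⟨fun _ _ => ⟨e, he, huniv⟩, fun _ _ => ⟨e, he, h⟩⟩
    · rfl
  rw [this]

/-- Failure probability of the DD decoder for a fixed graph with at most `M` edges and maximum
degree at most `d`. -/
lemma bernTestsProb_ddDecoder_ne_le {n t : ℕ} {p : ℝ} (hp0 : 0 ≤ p) (hp1 : p ≤ 1)
    {E : Finset (Sym2 (Fin n))} (hE : E ⊆ allPairs n) {d M D K : ℕ}
    (hd : ∀ v, degOf E v ≤ d) (hM : E.card ≤ M) (hD : 1 ≤ D) (hDK : D ≤ K) {ρ : ℝ}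
    (hρ : ρ ≤ isolationBound p (d + D) (M + K) * t) :
    bernTestsProb n t p (fun Ls => ddDecoder n t Ls (fun i => covers E (Ls i)) ≠ E) ≤
      n ^ 2 * Real.exp (-ρ) / K + n * (n ^ D * Real.exp (-(D * ρ))) + M * Real.exp (-ρ) := by
  set r := isolationBound p (d + D) (M + K) with hr
  have hK0 : (0 : ℝ) < K := by exact_mod_cast hD.trans hDK
  have hdegF : ∀ (F : Finset (Sym2 (Fin n))) (v : Fin n), F.card ≤ D →
      degOf (E ∪ F) v ≤ d + D := fun F v hF =>
    (degOf_union_le E F v).trans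
      (add_le_add (hd v) ((Finset.card_le_card (Finset.filter_subset _ _)).trans hF))
  have hcardF : ∀ F : Finset (Sym2 (Fin n)), F.card ≤ K → (E ∪ F).card ≤ M + K := fun F hF =>
    (Finset.card_union_le E F).trans (add_le_add hM hF)
  set many : (Fin t → Finset (Fin n)) → Prop := fun Ls =>
    K ≤ (possibleEdges E Ls \ E).card with hmany
  set star : Fin n → Finset (Sym2 (Fin n)) := fun v =>
    (allPairs n \ E).filter fun e => v ∈ e with hstar
  set clustered : (Fin t → Finset (Fin n)) → Prop := fun Ls =>
    ∃ v ∈ (Finset.univ : Finset (Fin n)), ∃ F ∈ (star v).powersetCard D,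
      F ⊆ possibleEdges E Ls with hclustered
  set missed : (Fin t → Finset (Fin n)) → Prop := fun Ls =>
    ∃ e ∈ E, r ≤ bernProb n p (isolates (possibleEdges E Ls) e) ∧
      ∀ i, ¬ isolates (possibleEdges E Ls) e (Ls i) with hmissed
  have hcover : ∀ Ls, ddDecoder n t Ls (fun i => covers E (Ls i)) ≠ E →
      (many Ls ∨ clustered Ls) ∨ missed Ls := by
    intro Ls hne
    by_contra! hno
    obtain ⟨⟨hmanyN, hclN⟩, hmissN⟩ := hno
    refine hne (ddDecoder_eq_of_isolates hE fun e he => ?_)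
    by_contra! hiso
    refine hmissN ⟨e, he, ?_, hiso⟩
    set P := possibleEdges E Ls with hP
    have hPE : E ∪ (P \ E) = P := Finset.union_sdiff_of_subset (subset_possibleEdges hE Ls)
    have hPall : P ⊆ allPairs n := fun f hf => (mem_possibleEdges.mp hf).1
    refine isolationBound_le_bernProb_isolates hp0 hp1 hPall (hE he) (fun v => ?_) ?_
    · rw [← hPE]
      refine (degOf_union_le _ _ v).trans (add_le_add (hd v) ?_)
      by_contra! hlt
      obtain ⟨F, hF, hFD⟩ := Finset.exists_subset_card_eq hlt.le
      refine hclN ⟨v, Finset.mem_univ v, F, Finset.mem_powersetCard.mpr ⟨fun f hf => ?_, hFD⟩,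
        fun f hf => ?_⟩
      · obtain ⟨hf1, hf2⟩ := Finset.mem_filter.mp (hF hf)
        exact Finset.mem_filter.mpr ⟨Finset.sdiff_subset_sdiff hPall le_rfl hf1, hf2⟩
      · exact (Finset.mem_sdiff.mp (Finset.mem_filter.mp (hF hf)).1).1
    · rw [← hPE]
      refine hcardF _ ?_
      exact (not_le.mp hmanyN).le
  have hmanyP : bernTestsProb n t p many ≤ n ^ 2 * Real.exp (-ρ) / K := by
    rw [le_div_iff₀ hK0]
    refine (bernTestsProb_le_card_mul_le hp0 hp1 (allPairs n \ E)
      (fun Ls => possibleEdges E Ls \ E) (fun Ls => Finset.sdiff_subset_sdiff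
        (fun f hf => (mem_possibleEdges.mp hf).1) le_rfl) K).trans ?_
    have hle : ∀ e ∈ allPairs n \ E,
        bernTestsProb n t p (fun Ls => e ∈ possibleEdges E Ls \ E) ≤ Real.exp (-ρ) := by
      intro e he
      refine (bernTestsProb_mono hp0 hp1 fun Ls hLs => Finset.singleton_subset_iff.mpr
        (Finset.mem_sdiff.mp hLs).1).trans ((bernTestsProb_subset_possibleEdges_le hp0 hp1 hE
        (Finset.singleton_subset_iff.mpr he) (fun v => hdegF {e} v (by simpa using hD))
        (hcardF {e} (by simpa using hD.trans hDK))).trans ?_)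
      rw [Finset.card_singleton, Nat.cast_one, one_mul]
      exact Real.exp_le_exp.mpr (neg_le_neg hρ)
    refine (Finset.sum_le_card_nsmul _ _ _ hle).trans ?_
    rw [nsmul_eq_mul]
    refine mul_le_mul_of_nonneg_right ?_ (Real.exp_pos _).le
    have : (allPairs n \ E).card ≤ n ^ 2 :=
      (Finset.card_le_card Finset.sdiff_subset).trans
        ((card_allPairs n).trans_le (Nat.choose_le_pow n 2))
    exact_mod_cast this
  have hclP : bernTestsProb n t p clustered ≤ n * (n ^ D * Real.exp (-(D * ρ))) := by
    refine (bernTestsProb_exists_le hp0 hp1 Finset.univ _).trans ?_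
    have hle : ∀ v ∈ (Finset.univ : Finset (Fin n)),
        bernTestsProb n t p (fun Ls => ∃ F ∈ (star v).powersetCard D, F ⊆ possibleEdges E Ls) ≤
          n ^ D * Real.exp (-(D * ρ)) := by
      intro v _
      refine (bernTestsProb_exists_le hp0 hp1 _ _).trans ?_
      have hleF : ∀ F ∈ (star v).powersetCard D,
          bernTestsProb n t p (fun Ls => F ⊆ possibleEdges E Ls) ≤ Real.exp (-(D * ρ)) := by
        intro F hF
        obtain ⟨hFs, hFD⟩ := Finset.mem_powersetCard.mp hF
        refine (bernTestsProb_subset_possibleEdges_le hp0 hp1 hE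
          (hFs.trans (Finset.filter_subset _ _)) (fun v => hdegF F v hFD.le)
          (hcardF F (hFD.le.trans hDK))).trans ?_
        rw [hFD, mul_assoc]
        exact Real.exp_le_exp.mpr
          (neg_le_neg (mul_le_mul_of_nonneg_left hρ (Nat.cast_nonneg D)))
      refine (Finset.sum_le_card_nsmul _ _ _ hleF).trans ?_
      rw [nsmul_eq_mul]
      refine mul_le_mul_of_nonneg_right ?_ (Real.exp_pos _).le
      have hs : (star v).card ≤ n :=
        (Finset.card_le_card (Finset.filter_subset_filter _ Finset.sdiff_subset)).trans
          (card_allPairs_filter_mem_le v)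
      have : ((star v).powersetCard D).card ≤ n ^ D := by
        rw [Finset.card_powersetCard]
        exact (Nat.choose_le_pow _ D).trans (Nat.pow_le_pow_left hs D)
      exact_mod_cast this
    refine (Finset.sum_le_card_nsmul _ _ _ hle).trans ?_
    rw [nsmul_eq_mul, Finset.card_univ, Fintype.card_fin]
  have hmissP : bernTestsProb n t p missed ≤ M * Real.exp (-ρ) := by
    refine (bernTestsProb_exists_le hp0 hp1 E _).trans ?_
    refine (Finset.sum_le_card_nsmul _ _ (Real.exp (-ρ)) fun e he =>
      (bernTestsProb_not_isolates_le hp0 hp1 he r).trans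
        (Real.exp_le_exp.mpr (neg_le_neg hρ))).trans ?_
    rw [nsmul_eq_mul]
    exact mul_le_mul_of_nonneg_right (by exact_mod_cast hM) (Real.exp_pos _).le
  have h1 := bernTestsProb_mono (p := p) hp0 hp1 hcover
  have h2 := bernTestsProb_or_le hp0 hp1 (fun Ls => many Ls ∨ clustered Ls) missed
  have h3 := bernTestsProb_or_le hp0 hp1 many clustered
  linarith

lemma erWeight_nonneg {q : ℝ} (hq0 : 0 ≤ q) (hq1 : q ≤ 1) (n : ℕ) (E : Finset (Sym2 (Fin n))) :
    0 ≤ erWeight n q E :=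
  mul_nonneg (pow_nonneg hq0 _) (pow_nonneg (by linarith) _)

lemma sum_erWeight_mul_prod (n : ℕ) (q : ℝ) (a : Sym2 (Fin n) → ℝ) :
    ∑ E ∈ (allPairs n).powerset, erWeight n q E * ∏ e ∈ E, a e =
      ∏ e ∈ allPairs n, (q * a e + (1 - q)) := by
  rw [Finset.prod_add]
  refine Finset.sum_congr rfl fun E hE => ?_
  rw [Finset.prod_mul_distrib, Finset.prod_const, Finset.prod_const,
    Finset.card_sdiff_of_subset (Finset.mem_powerset.mp hE), erWeight]
  ring

lemma sum_erWeight (n : ℕ) (q : ℝ) : ∑ E ∈ (allPairs n).powerset, erWeight n q E = 1 := by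
  simpa using sum_erWeight_mul_prod n q fun _ => 1

/-- Chernoff bound for the number of edges satisfying `c`. -/
lemma erProb_le_card_filter_le {n : ℕ} {q : ℝ} (hq0 : 0 ≤ q) (hq1 : q ≤ 1)
    (c : Sym2 (Fin n) → Prop) [DecidablePred c] {s : ℝ} (hs : 0 ≤ s) (a : ℝ) :
    erProb n q (fun E => a ≤ (E.filter c).card) ≤
      Real.exp (q * (Real.exp s - 1) * ((allPairs n).filter c).card - s * a) := by
  have hmgf : ∑ E ∈ (allPairs n).powerset,
      erWeight n q E * Real.exp (s * (E.filter c).card) ≤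
      Real.exp (q * (Real.exp s - 1) * ((allPairs n).filter c).card) := by
    have hprod : ∀ E : Finset (Sym2 (Fin n)), Real.exp (s * (E.filter c).card) =
        ∏ e ∈ E, if c e then Real.exp s else 1 := by
      intro E
      rw [Finset.prod_ite, Finset.prod_const, Finset.prod_const_one, mul_one, mul_comm,
        Real.exp_nat_mul]
    simp_rw [hprod]
    rw [sum_erWeight_mul_prod, mul_comm (q * _), Real.exp_nat_mul, ← Finset.prod_const,
      Finset.prod_filter]
    have hexp := Real.one_le_exp hs
    refine Finset.prod_le_prod (fun e _ => ?_) fun e _ => ?_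
    · split_ifs
      · nlinarith
      · linarith
    · split_ifs
      · linarith [Real.add_one_le_exp (q * (Real.exp s - 1))]
      · linarith
  rw [sub_eq_add_neg, Real.exp_add]
  refine le_trans ?_ (mul_le_mul_of_nonneg_right hmgf (Real.exp_pos _).le)
  rw [erProb, Finset.sum_mul]
  refine Finset.sum_le_sum fun E _ => ?_
  have hw := erWeight_nonneg hq0 hq1 n E
  split_ifs with h
  · rw [mul_assoc, ← Real.exp_add]
    refine le_mul_of_one_le_right hw (Real.one_le_exp ?_)
    nlinarith
  · positivity

lemma erProb_lt_card_le {n : ℕ} {q ε : ℝ} (hq0 : 0 ≤ q) (hq1 : q ≤ 1) (hε0 : 0 ≤ ε)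
    (hε1 : ε ≤ 1) {M : ℕ} (hM : (1 + ε) * (q * n.choose 2) ≤ M + 1) :
    erProb n q (fun E => ((M + 1 : ℕ) : ℝ) ≤ (E.filter fun _ => True).card) ≤
      Real.exp (-(ε ^ 2 / 4 * (q * n.choose 2))) := by
  refine (erProb_le_card_filter_le hq0 hq1 (fun _ => True) (s := ε / 2) (by linarith) _).trans ?_
  rw [Real.exp_le_exp, Finset.filter_true, card_allPairs]
  have hk : 0 ≤ q * n.choose 2 := by positivity
  have habs := Real.abs_exp_sub_one_sub_id_le (x := ε / 2) (by rw [abs_le]; constructor <;> linarith)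
  have hexp : Real.exp (ε / 2) - 1 ≤ ε / 2 + (ε / 2) ^ 2 := by linarith [(abs_le.mp habs).2]
  have h1 := mul_le_mul_of_nonneg_left hexp hk
  have h2 := mul_le_mul_of_nonneg_left hM (by linarith : 0 ≤ ε / 2)
  push_cast
  nlinarith

lemma erProb_lt_degOf_le {n : ℕ} {q : ℝ} (hq0 : 0 ≤ q) (hq1 : q ≤ 1) (v : Fin n) (d : ℕ) :
    erProb n q (fun E => ((d + 1 : ℕ) : ℝ) ≤ degOf E v) ≤ Real.exp (2 * n * q - (d + 1)) := by
  refine (erProb_le_card_filter_le hq0 hq1 (fun e => v ∈ e) (s := 1) zero_le_one _).trans ?_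
  rw [Real.exp_le_exp]
  have hcard : (((allPairs n).filter fun e => v ∈ e).card : ℝ) ≤ n := by
    exact_mod_cast card_allPairs_filter_mem_le v
  have hexp : Real.exp 1 - 1 ≤ 2 := by linarith [Real.exp_one_lt_d9]
  have h1 : q * (Real.exp 1 - 1) ≤ q * 2 := mul_le_mul_of_nonneg_left hexp hq0
  have h2 := mul_le_mul h1 hcard (by positivity) (by positivity)
  push_cast
  linarith

lemma erTestsProb_eq (n t : ℕ) (q p : ℝ)
    (A : Finset (Sym2 (Fin n)) → (Fin t → Finset (Fin n)) → Prop) :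
    erTestsProb n t q p A =
      ∑ E ∈ (allPairs n).powerset, erWeight n q E * bernTestsProb n t p (A E) := by
  refine Finset.sum_congr rfl fun E _ => ?_
  rw [bernTestsProb, Finset.mul_sum]
  exact Finset.sum_congr rfl fun Ls _ => by rw [mul_ite, mul_zero]

lemma bernTestsProb_nonneg {n t : ℕ} {p : ℝ} (hp0 : 0 ≤ p) (hp1 : p ≤ 1)
    (A : (Fin t → Finset (Fin n)) → Prop) : 0 ≤ bernTestsProb n t p A :=
  Finset.sum_nonneg fun Ls _ => by
    have := testsWeight_nonneg hp0 hp1 n t Ls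
    split_ifs <;> simp [this]

lemma bernTestsProb_le_one {n t : ℕ} {p : ℝ} (hp0 : 0 ≤ p) (hp1 : p ≤ 1)
    (A : (Fin t → Finset (Fin n)) → Prop) : bernTestsProb n t p A ≤ 1 := by
  refine (bernTestsProb_mono hp0 hp1 (B := fun _ => True) fun _ _ => trivial).trans_eq ?_
  simp [bernTestsProb, sum_testsWeight]

lemma erTestsProb_nonneg {n t : ℕ} {q p : ℝ} (hq0 : 0 ≤ q) (hq1 : q ≤ 1) (hp0 : 0 ≤ p)
    (hp1 : p ≤ 1) (A : Finset (Sym2 (Fin n)) → (Fin t → Finset (Fin n)) → Prop) :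
    0 ≤ erTestsProb n t q p A := by
  rw [erTestsProb_eq]
  exact Finset.sum_nonneg fun E _ =>
    mul_nonneg (erWeight_nonneg hq0 hq1 n E) (bernTestsProb_nonneg hp0 hp1 _)

/-- Failure probability of the DD decoder over the random graph and the tests. -/
lemma erTestsProb_ddDecoder_ne_le {n t : ℕ} {q p ε ρ : ℝ} (hq0 : 0 ≤ q) (hq1 : q ≤ 1)
    (hp0 : 0 ≤ p) (hp1 : p ≤ 1) (hε0 : 0 ≤ ε) (hε1 : ε ≤ 1) {d M D K : ℕ}
    (hM : (1 + ε) * (q * n.choose 2) ≤ M + 1) (hD : 1 ≤ D) (hDK : D ≤ K)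
    (hρ : ρ ≤ isolationBound p (d + D) (M + K) * t) :
    erTestsProb n t q p (fun E Ls => ddDecoder n t Ls (fun i => covers E (Ls i)) ≠ E) ≤
      Real.exp (-(ε ^ 2 / 4 * (q * n.choose 2))) + n * Real.exp (2 * n * q - (d + 1)) +
      (n ^ 2 * Real.exp (-ρ) / K + n * (n ^ D * Real.exp (-(D * ρ))) + M * Real.exp (-ρ)) := by
  set b := n ^ 2 * Real.exp (-ρ) / K + n * (n ^ D * Real.exp (-(D * ρ))) + M * Real.exp (-ρ)
    with hb
  have hb0 : 0 ≤ b := by positivity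
  have hcard := erProb_lt_card_le hq0 hq1 hε0 hε1 hM
  have hdeg : ∑ v : Fin n, erProb n q (fun E => ((d + 1 : ℕ) : ℝ) ≤ degOf E v) ≤
      n * Real.exp (2 * n * q - (d + 1)) := by
    refine (Finset.sum_le_card_nsmul _ _ _ fun v _ =>
      erProb_lt_degOf_le hq0 hq1 v d).trans_eq ?_
    rw [nsmul_eq_mul, Finset.card_univ, Fintype.card_fin]
  have hsum : ∑ E ∈ (allPairs n).powerset, erWeight n q E * b = b := by
    rw [← Finset.sum_mul, sum_erWeight, one_mul]
  refine le_trans ?_ (add_le_add (add_le_add hcard hdeg) hsum.le)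
  simp only [erProb]
  rw [erTestsProb_eq, Finset.sum_comm, ← Finset.sum_add_distrib, ← Finset.sum_add_distrib]
  refine Finset.sum_le_sum fun E hE => ?_
  have hw := erWeight_nonneg hq0 hq1 n E
  have hone := bernTestsProb_le_one (t := t) hp0 hp1
    (fun Ls => ddDecoder n t Ls (fun i => covers E (Ls i)) ≠ E)
  have hwone := mul_le_of_le_one_right hw hone
  have hterm : ∀ v ∈ (Finset.univ : Finset (Fin n)),
      0 ≤ if ((d + 1 : ℕ) : ℝ) ≤ degOf E v then erWeight n q E else 0 := fun v _ => by
    split_ifs <;> simp [hw]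
  have hsum0 := Finset.sum_nonneg hterm
  have hwb : 0 ≤ erWeight n q E * b := mul_nonneg hw hb0
  by_cases h1 : ((M + 1 : ℕ) : ℝ) ≤ (E.filter fun _ => True).card
  · rw [if_pos h1]
    linarith
  rw [if_neg h1, zero_add]
  by_cases h2 : ∃ v, ((d + 1 : ℕ) : ℝ) ≤ degOf E v
  · obtain ⟨v, hv⟩ := h2
    have hsingle := Finset.single_le_sum hterm (Finset.mem_univ v)
    rw [if_pos hv] at hsingle
    linarith
  · refine le_add_of_nonneg_of_le hsum0 (mul_le_mul_of_nonneg_left ?_ hw)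
    push Not at h2
    rw [Finset.filter_true, not_le, Nat.cast_lt, Nat.lt_succ_iff] at h1
    exact bernTestsProb_ddDecoder_ne_le hp0 hp1 (Finset.mem_powerset.mp hE)
      (fun v => Nat.lt_succ_iff.mp (by exact_mod_cast h2 v)) h1 hD hDK hρ

lemma le_isolationBound_mul {p k x ε : ℝ} {d N : ℕ} (hp0 : 0 ≤ p) (hp1 : p < 1) (hk : 0 ≤ k)
    (hpk : p ^ 2 * k ≤ 1) (hε : 0 ≤ ε) (hd : (d : ℝ) ≤ x) (hN : (N : ℝ) ≤ (1 + 2 * ε) * k) :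
    p ^ 2 * k * ((1 - 2 * (p * x)) * Real.exp (1 - (1 + 2 * ε) / (1 - p ^ 2))) ≤
      isolationBound p d N * (Real.exp 1 * k) := by
  have hpp : 0 < 1 - p ^ 2 := by nlinarith
  have h1p : 0 ≤ 1 - p := by linarith
  have hpow : 1 - 2 * (p * x) ≤ (1 - p) ^ (2 * d) := by
    have h := one_add_mul_le_pow (a := -p) (by linarith) (2 * d)
    push_cast at h
    rw [← sub_eq_add_neg] at h
    nlinarith
  have hexp : Real.exp (1 - (1 + 2 * ε) / (1 - p ^ 2)) ≤ Real.exp 1 * (1 - p ^ 2) ^ N := by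
    have hbase : Real.exp (-(p ^ 2 / (1 - p ^ 2))) ≤ 1 - p ^ 2 := by
      rw [Real.exp_neg]
      refine inv_le_of_inv_le₀ hpp ?_
      have h := Real.add_one_le_exp (p ^ 2 / (1 - p ^ 2))
      have heq : p ^ 2 / (1 - p ^ 2) + 1 = (1 - p ^ 2)⁻¹ := by
        field_simp
        ring
      linarith
    rw [sub_eq_add_neg, Real.exp_add]
    refine mul_le_mul_of_nonneg_left ?_ (Real.exp_pos 1).le
    refine le_trans ?_ (pow_le_pow_left₀ (Real.exp_pos _).le hbase N)
    rw [← Real.exp_nat_mul, Real.exp_le_exp, mul_neg, neg_le_neg_iff, ← mul_div_assoc]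
    refine div_le_div_of_nonneg_right ?_ hpp.le
    nlinarith [mul_le_mul_of_nonneg_right hN (sq_nonneg p)]
  calc p ^ 2 * k * ((1 - 2 * (p * x)) * Real.exp (1 - (1 + 2 * ε) / (1 - p ^ 2)))
      ≤ p ^ 2 * k * ((1 - p) ^ (2 * d) * (Real.exp 1 * (1 - p ^ 2) ^ N)) := by
        refine mul_le_mul_of_nonneg_left ?_ (by positivity)
        exact mul_le_mul hpow hexp (Real.exp_pos _).le (by positivity)
    _ = isolationBound p d N * (Real.exp 1 * k) := by
        rw [isolationBound]
        ring

lemma tendsto_exp_neg_mul_log {a : ℝ} (ha : 0 < a) :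
    Tendsto (fun n : ℕ => Real.exp (-(a * Real.log n))) atTop (nhds 0) :=
  Real.tendsto_exp_neg_atTop_nhds_zero.comp
    ((Real.tendsto_log_atTop.comp tendsto_natCast_atTop_atTop).const_mul_atTop ha)

lemma tendsto_natCast_rpow_neg {a : ℝ} (ha : 0 < a) :
    Tendsto (fun n : ℕ => (n : ℝ) ^ (-a)) atTop (nhds 0) :=
  (tendsto_rpow_neg_atTop ha).comp tendsto_natCast_atTop_atTop

lemma tendsto_natCast_rpow_neg_mul_log {a : ℝ} (ha : 0 < a) :
    Tendsto (fun n : ℕ => (n : ℝ) ^ (-a) * Real.log n) atTop (nhds 0) := by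
  have h := (isLittleO_log_rpow_atTop ha).tendsto_div_nhds_zero.comp tendsto_natCast_atTop_atTop
  refine h.congr fun n => ?_
  simp only [Function.comp_apply]
  rw [Real.rpow_neg (Nat.cast_nonneg n), div_eq_inv_mul]

lemma natCast_choose_two_eq (n : ℕ) : ((n.choose 2 : ℕ) : ℝ) = n * (n - 1) / 2 :=
  Nat.cast_choose_two ℝ n

/-- With inclusion probability `√(2 / (q n²))` the isolation probability is asymptotically at least
`exp (-2 ε) / (e k̄)`. -/
lemma eventually_le_isolationBound {θ : ℝ} (hθ0 : 0 < θ) (hθ1 : θ < 1) {q : ℕ → ℝ} {c₁ c₂ : ℝ}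
    (hc₁ : 0 < c₁)
    (hq : ∀ n : ℕ, c₁ * (n : ℝ) ^ (2 * (θ - 1)) ≤ q n ∧ q n ≤ c₂ * (n : ℝ) ^ (2 * (θ - 1)))
    {ε c : ℝ} (hε : 0 ≤ ε) (hc : c < Real.exp (-(2 * ε))) (D : ℕ) :
    ∀ᶠ n : ℕ in atTop, Real.sqrt (2 / (q n * (n : ℝ) ^ 2)) ≤ 1 ∧
      ∀ d N : ℕ, (d : ℝ) ≤ 2 * n * q n + 2 * Real.log n + D → (N : ℝ) ≤ (1 + 2 * ε) * kbar q n →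
        c ≤ isolationBound (Real.sqrt (2 / (q n * (n : ℝ) ^ 2))) d N *
          (Real.exp 1 * kbar q n) := by
  set p : ℕ → ℝ := fun n => Real.sqrt (2 / (q n * (n : ℝ) ^ 2)) with hp
  set x : ℕ → ℝ := fun n => 2 * n * q n + 2 * Real.log n + D with hx
  set C := Real.sqrt (2 / c₁) with hC
  have hC0 : 0 ≤ C := Real.sqrt_nonneg _
  have hp0 : ∀ n, 0 ≤ p n := fun n => Real.sqrt_nonneg _
  have hqpos : ∀ n : ℕ, 1 ≤ n → 0 < q n := fun n hn =>
    lt_of_lt_of_le (by positivity) (hq n).1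
  have hple : ∀ n : ℕ, 1 ≤ n → p n ≤ C * (n : ℝ) ^ (-θ) := by
    intro n hn
    have hn0 : (0 : ℝ) < n := by exact_mod_cast hn
    refine Real.sqrt_le_iff.mpr ⟨by positivity, ?_⟩
    rw [mul_pow, hC, Real.sq_sqrt (by positivity), ← Real.rpow_natCast ((n : ℝ) ^ (-θ)),
      ← Real.rpow_mul hn0.le]
    have h := mul_le_mul_of_nonneg_right (hq n).1 (sq_nonneg (n : ℝ))
    have hpow : (n : ℝ) ^ (2 * (θ - 1)) * (n : ℝ) ^ 2 = (n : ℝ) ^ (2 * θ) := by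
      rw [← Real.rpow_natCast (n : ℝ) 2, ← Real.rpow_add hn0]
      congr 1
      push_cast
      ring
    rw [mul_assoc, hpow] at h
    have hneg : (n : ℝ) ^ (-θ * ((2 : ℕ) : ℝ)) = ((n : ℝ) ^ (2 * θ))⁻¹ := by
      rw [← Real.rpow_neg hn0.le]
      congr 1
      push_cast
      ring
    rw [hneg, ← div_eq_mul_inv, div_div]
    exact div_le_div_of_nonneg_left (by norm_num) (by positivity) h
  have hp_lim : Tendsto p atTop (nhds 0) := by
    have h := (tendsto_natCast_rpow_neg hθ0).const_mul C
    rw [mul_zero] at h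
    refine squeeze_zero' (Eventually.of_forall hp0) ?_ h
    filter_upwards [eventually_ge_atTop 1] with n hn using hple n hn
  have hpx_lim : Tendsto (fun n => p n * x n) atTop (nhds 0) := by
    have h := ((((tendsto_natCast_rpow_neg (sub_pos.mpr hθ1)).const_mul (2 * C * c₂)).add
      ((tendsto_natCast_rpow_neg_mul_log hθ0).const_mul (2 * C))).add
      ((tendsto_natCast_rpow_neg hθ0).const_mul (C * D)))
    simp only [mul_zero, add_zero] at h
    have hx0 : ∀ n : ℕ, 1 ≤ n → 0 ≤ x n := by
      intro n hn
      have h1 := (hqpos n hn).le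
      have h2 := Real.log_natCast_nonneg n
      simp only [hx]
      positivity
    refine squeeze_zero' ?_ ?_ h
    · filter_upwards [eventually_ge_atTop 1] with n hn using mul_nonneg (hp0 n) (hx0 n hn)
    · filter_upwards [eventually_ge_atTop 1] with n hn
      have hn0 : (0 : ℝ) < n := by exact_mod_cast hn
      refine (mul_le_mul_of_nonneg_right (hple n hn) (hx0 n hn)).trans ?_
      have hpow : (n : ℝ) ^ (-θ) * (n * (n : ℝ) ^ (2 * (θ - 1))) = (n : ℝ) ^ (-(1 - θ)) := by
        nth_rewrite 2 [← Real.rpow_one (n : ℝ)]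
        rw [← Real.rpow_add hn0, ← Real.rpow_add hn0]
        congr 1
        ring
      have hqn := mul_le_mul_of_nonneg_left (hq n).2
        (by positivity : 0 ≤ 2 * C * ((n : ℝ) ^ (-θ) * n))
      rw [← hpow]
      simp only [hx]
      linarith
  have hpk : ∀ n : ℕ, 1 ≤ n → p n ^ 2 * kbar q n = 1 - 1 / (n : ℝ) := by
    intro n hn
    have hn0 : (0 : ℝ) < n := by exact_mod_cast hn
    have hq0 := hqpos n hn
    rw [hp, Real.sq_sqrt (by positivity), kbar, natCast_choose_two_eq]
    field_simp
  have hlim : Tendsto (fun n : ℕ => (1 - 1 / (n : ℝ)) * ((1 - 2 * (p n * x n)) *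
      Real.exp (1 - (1 + 2 * ε) / (1 - p n ^ 2)))) atTop (nhds (Real.exp (-(2 * ε)))) := by
    have h1 : Tendsto (fun n : ℕ => 1 - 1 / (n : ℝ)) atTop (nhds (1 - 0)) :=
      tendsto_const_nhds.sub tendsto_one_div_atTop_nhds_zero_nat
    have h2 : Tendsto (fun n => 1 - 2 * (p n * x n)) atTop (nhds (1 - 2 * 0)) :=
      tendsto_const_nhds.sub (hpx_lim.const_mul 2)
    have h3 : Tendsto (fun n => 1 - p n ^ 2) atTop (nhds (1 - 0 ^ 2)) :=
      tendsto_const_nhds.sub (hp_lim.pow 2)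
    have h4 : Tendsto (fun n => Real.exp (1 - (1 + 2 * ε) / (1 - p n ^ 2))) atTop
        (nhds (Real.exp (1 - (1 + 2 * ε) / (1 - 0 ^ 2)))) :=
      (Real.continuous_exp.tendsto _).comp
        (tendsto_const_nhds.sub (tendsto_const_nhds.div h3 (by norm_num)))
    convert h1.mul (h2.mul h4) using 2
    norm_num
  filter_upwards [hlim.eventually_const_lt hc, hp_lim.eventually_lt_const zero_lt_one,
    eventually_ge_atTop 1] with n hcn hpn hn
  have hq0 := hqpos n hn
  refine ⟨hpn.le, fun d N hd hN => hcn.le.trans ?_⟩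
  rw [← hpk n hn]
  refine le_isolationBound_mul (hp0 n) hpn (by unfold kbar; positivity) ?_ hε hd hN
  rw [hpk n hn]
  have : 0 ≤ 1 / (n : ℝ) := by positivity
  linarith

set_option maxHeartbeats 1000000 in
/-- The bound on the failure probability of the DD decoder, in terms of powers of `n`. -/
lemma ddDecoder_failure_bound_le {θ c₁ c₂ η ε qn : ℝ} {n d M D K : ℕ}
    (hn : 2 ≤ n) (hc₁ : 0 < c₁) (hη : 0 < η) (hε0 : 0 < ε) (hε1 : ε ≤ 1)
    (hq1 : c₁ * (n : ℝ) ^ (2 * (θ - 1)) ≤ qn) (hq2 : qn ≤ c₂ * (n : ℝ) ^ (2 * (θ - 1)))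
    (hd : 2 * n * qn + 2 * Real.log n ≤ d + 1) (hM : (M : ℝ) ≤ (1 + ε) * (qn * n.choose 2))
    (hK : ε * (qn * n.choose 2) / 2 ≤ K) (hD : 4 ≤ D * η) :
    Real.exp (-(ε ^ 2 / 4 * (qn * n.choose 2))) + n * Real.exp (2 * n * qn - (d + 1)) +
      (n ^ 2 * Real.exp (-((1 + η / 2) * (2 * max θ (1 - θ) * Real.log n))) / K +
        n * (n ^ D * Real.exp (-(D * ((1 + η / 2) * (2 * max θ (1 - θ) * Real.log n))))) +
        M * Real.exp (-((1 + η / 2) * (2 * max θ (1 - θ) * Real.log n)))) ≤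
    Real.exp (-(ε ^ 2 * c₁ * θ / 8 * Real.log n)) + Real.exp (-(1 * Real.log n)) +
      (8 / (ε * c₁) * Real.exp (-(η * (1 - θ) * Real.log n)) + Real.exp (-(1 * Real.log n)) +
        c₂ * Real.exp (-(η * θ * Real.log n))) := by
  have hn2 : (2 : ℝ) ≤ n := by exact_mod_cast hn
  have hn0 : (0 : ℝ) < n := by linarith
  set l := Real.log n with hl
  have hl0 : 0 ≤ l := Real.log_natCast_nonneg n
  have hnl : (n : ℝ) = Real.exp l := (Real.exp_log hn0).symm
  set m := max θ (1 - θ) with hm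
  have hm1 : θ ≤ m := le_max_left _ _
  have hm2 : 1 - θ ≤ m := le_max_right _ _
  set k := qn * n.choose 2 with hk
  have hpow : (n : ℝ) ^ (2 * (θ - 1)) * (n : ℝ) ^ 2 = Real.exp (2 * θ * l) := by
    rw [Real.rpow_def_of_pos hn0, ← hl, hnl, ← Real.exp_nat_mul, ← Real.exp_add]
    congr 1
    push_cast
    ring
  have hqn0 : 0 ≤ qn := le_trans (by positivity) hq1
  have hklow : c₁ / 4 * Real.exp (2 * θ * l) ≤ k := by
    have h := mul_le_mul_of_nonneg_right hq1 (sq_nonneg (n : ℝ))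
    rw [mul_assoc, hpow] at h
    rw [hk, natCast_choose_two_eq]
    nlinarith [mul_nonneg hqn0 (mul_nonneg hn0.le (sub_nonneg.mpr hn2))]
  have hkup : k ≤ c₂ / 2 * Real.exp (2 * θ * l) := by
    have h := mul_le_mul_of_nonneg_right hq2 (sq_nonneg (n : ℝ))
    rw [mul_assoc, hpow] at h
    rw [hk, natCast_choose_two_eq]
    nlinarith [mul_nonneg hqn0 hn0.le]
  have hk0 : 0 < k := lt_of_lt_of_le (by positivity) hklow
  have hc₂ : 0 < c₂ := by
    by_contra! h
    nlinarith [Real.exp_pos (2 * θ * l)]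
  refine add_le_add (add_le_add ?_ ?_) (add_le_add (add_le_add ?_ ?_) ?_)
  · rw [Real.exp_le_exp, neg_le_neg_iff]
    have h1 : 2 * θ * l ≤ Real.exp (2 * θ * l) := by
      linarith [Real.add_one_le_exp (2 * θ * l)]
    have h2 : c₁ / 4 * (2 * θ * l) ≤ k :=
      (mul_le_mul_of_nonneg_left h1 (by positivity)).trans hklow
    nlinarith [mul_le_mul_of_nonneg_left h2 (by positivity : 0 ≤ ε ^ 2 / 4)]
  · calc (n : ℝ) * Real.exp (2 * n * qn - (d + 1))
        = Real.exp (l + (2 * n * qn - (d + 1))) := by rw [Real.exp_add, ← hnl]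
      _ ≤ _ := Real.exp_le_exp.mpr (by linarith)
  · have hKlow : ε * c₁ / 8 * Real.exp (2 * θ * l) ≤ K := by
      nlinarith [mul_le_mul_of_nonneg_left hklow hε0.le]
    have hK0 : (0 : ℝ) < K := lt_of_lt_of_le (by positivity) hKlow
    rw [div_le_iff₀ hK0]
    refine le_trans ?_ (mul_le_mul_of_nonneg_left hKlow (by positivity))
    have hright : 8 / (ε * c₁) * Real.exp (-(η * (1 - θ) * l)) *
        (ε * c₁ / 8 * Real.exp (2 * θ * l)) = Real.exp (-(η * (1 - θ) * l) + 2 * θ * l) := by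
      rw [Real.exp_add]
      field_simp
    rw [hright, hnl, ← Real.exp_nat_mul, ← Real.exp_add, Real.exp_le_exp]
    push_cast
    nlinarith [mul_le_mul_of_nonneg_right hm2 hl0, mul_nonneg hη.le hl0,
      mul_le_mul_of_nonneg_right hm2 (mul_nonneg hη.le hl0)]
  · rw [hnl, ← Real.exp_nat_mul, ← Real.exp_add, ← Real.exp_add, Real.exp_le_exp]
    have hm3 : 1 ≤ 2 * m := by linarith
    have h1 := mul_le_mul_of_nonneg_left hm3
      (by positivity : 0 ≤ (D : ℝ) * ((1 + η / 2) * l))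
    have h2 := mul_le_mul_of_nonneg_right hD hl0
    nlinarith
  · calc (M : ℝ) * Real.exp (-((1 + η / 2) * (2 * m * l)))
        ≤ c₂ * Real.exp (2 * θ * l) * Real.exp (-((1 + η / 2) * (2 * m * l))) := by
          refine mul_le_mul_of_nonneg_right ?_ (Real.exp_pos _).le
          linarith [mul_le_mul_of_nonneg_right hε1 hk0.le]
      _ = c₂ * Real.exp (2 * θ * l + -((1 + η / 2) * (2 * m * l))) := by
          rw [Real.exp_add, mul_assoc]
      _ ≤ c₂ * Real.exp (-(η * θ * l)) := by
          refine mul_le_mul_of_nonneg_left (Real.exp_le_exp.mpr ?_) hc₂.le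
          linarith [mul_le_mul_of_nonneg_right hm1 hl0,
            mul_le_mul_of_nonneg_right hm1 (mul_nonneg hη.le hl0)]

lemma tendsto_kbar_atTop {θ : ℝ} (hθ0 : 0 < θ) {q : ℕ → ℝ} {c₁ : ℝ} (hc₁ : 0 < c₁)
    (hq : ∀ n : ℕ, c₁ * (n : ℝ) ^ (2 * (θ - 1)) ≤ q n) : Tendsto (kbar q) atTop atTop := by
  have h : Tendsto (fun n : ℕ => c₁ / 4 * (n : ℝ) ^ (2 * θ)) atTop atTop :=
    ((tendsto_rpow_atTop (by linarith)).comp tendsto_natCast_atTop_atTop).const_mul_atTop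
      (by positivity)
  refine tendsto_atTop_mono' _ ?_ h
  filter_upwards [eventually_ge_atTop 2] with n hn
  have hn2 : (2 : ℝ) ≤ n := by exact_mod_cast hn
  have hn0 : (0 : ℝ) < n := by linarith
  have hpow : (n : ℝ) ^ (2 * (θ - 1)) * (n : ℝ) ^ 2 = (n : ℝ) ^ (2 * θ) := by
    rw [← Real.rpow_natCast (n : ℝ) 2, ← Real.rpow_add hn0]
    congr 1
    push_cast
    ring
  have hqn0 : 0 ≤ q n := le_trans (by positivity) (hq n)
  have h := mul_le_mul_of_nonneg_right (hq n) (sq_nonneg (n : ℝ))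
  rw [mul_assoc, hpow] at h
  rw [kbar, natCast_choose_two_eq]
  nlinarith [mul_nonneg hqn0 (mul_nonneg hn0.le (sub_nonneg.mpr hn2))]

/-- DD upper bound, Theorem 3.
Fix `θ ∈ (0,1)` and `q = Θ(n^{2(θ−1)})`, let `G ~ ER(n,q)` with `k̄ = q·C(n,2)`, and perform
`t` i.i.d. Bernoulli(p) tests with `p = √(2/(q n²))`.  If for some `η > 0` one has
`t ≥ (1+η)·2·max{θ,1−θ}·e·k̄·ln n` for all `n`, then `P[Ê_DD ≠ E(G)] → 0`. -/
theorem statement2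
    (θ : ℝ) (hθ0 : 0 < θ) (hθ1 : θ < 1)
    (q : ℕ → ℝ) (hq01 : ∀ n, 0 ≤ q n ∧ q n ≤ 1)
    (c₁ c₂ : ℝ) (hc₁ : 0 < c₁)
    (hq : ∀ n : ℕ, c₁ * (n : ℝ) ^ (2 * (θ - 1)) ≤ q n ∧ q n ≤ c₂ * (n : ℝ) ^ (2 * (θ - 1)))
    (t : ℕ → ℕ) (η : ℝ) (hη : 0 < η)
    (ht : ∀ n : ℕ,
      (1 + η) * (2 * max θ (1 - θ) * Real.exp 1 * kbar q n * Real.log n) ≤ (t n : ℝ)) :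
    Tendsto (fun n => erTestsProb n (t n) (q n) (Real.sqrt (2 / (q n * (n : ℝ) ^ 2)))
        (fun E Ls => ddDecoder n (t n) Ls (fun i => covers E (Ls i)) ≠ E))
      atTop (nhds 0) := by
  set ε := min 1 (Real.log ((1 + η) / (1 + η / 2)) / 4) with hε
  have hratio : 1 < (1 + η) / (1 + η / 2) := by
    rw [one_lt_div (by positivity)]
    linarith
  have hlog := Real.log_pos hratio
  have hε0 : 0 < ε := lt_min one_pos (by positivity)
  have hε1 : ε ≤ 1 := min_le_left _ _
  have hc : (1 + η / 2) / (1 + η) < Real.exp (-(2 * ε)) := by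
    have h4 : ε ≤ Real.log ((1 + η) / (1 + η / 2)) / 4 := min_le_right _ _
    rw [← Real.log_lt_iff_lt_exp (by positivity), ← inv_div, Real.log_inv]
    linarith
  obtain ⟨D, hD⟩ : ∃ D : ℕ, 4 / η ≤ D := exists_nat_ge _
  have hDη : 4 ≤ D * η := (div_le_iff₀ hη).mp hD
  have hD1 : 1 ≤ D := by
    by_contra! h
    obtain rfl : D = 0 := by omega
    norm_num at hDη
  have hlim : Tendsto (fun n : ℕ =>
      Real.exp (-(ε ^ 2 * c₁ * θ / 8 * Real.log n)) + Real.exp (-(1 * Real.log n)) +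
      (8 / (ε * c₁) * Real.exp (-(η * (1 - θ) * Real.log n)) + Real.exp (-(1 * Real.log n)) +
        c₂ * Real.exp (-(η * θ * Real.log n)))) atTop (nhds 0) := by
    have h1θ : 0 < 1 - θ := sub_pos.mpr hθ1
    have h := ((tendsto_exp_neg_mul_log (by positivity : 0 < ε ^ 2 * c₁ * θ / 8)).add
      (tendsto_exp_neg_mul_log one_pos)).add
      ((((tendsto_exp_neg_mul_log (mul_pos hη h1θ)).const_mul (8 / (ε * c₁))).add
        (tendsto_exp_neg_mul_log one_pos)).add
        ((tendsto_exp_neg_mul_log (mul_pos hη hθ0)).const_mul c₂))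
    simpa only [mul_zero, add_zero] using h
  have hkbar := (tendsto_kbar_atTop hθ0 hc₁ fun n => (hq n).1).const_mul_atTop hε0
  have hiso := eventually_le_isolationBound hθ0 hθ1 hc₁ hq hε0.le hc D
  refine squeeze_zero' ?_ ?_ hlim
  · filter_upwards [hiso] with n hn
    exact erTestsProb_nonneg (hq01 n).1 (hq01 n).2 (Real.sqrt_nonneg _) hn.1 _
  · filter_upwards [hiso, hkbar.eventually_ge_atTop (D : ℝ), hkbar.eventually_ge_atTop 2,
      eventually_ge_atTop 2] with n ⟨hp1, hr⟩ hDk h2k hn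
    obtain ⟨hq0, hq1⟩ := hq01 n
    have hl0 := Real.log_natCast_nonneg n
    have hk0 : 0 ≤ kbar q n := mul_nonneg hq0 (Nat.cast_nonneg _)
    set d := ⌊2 * n * q n + 2 * Real.log n⌋₊ with hd
    set M := ⌊(1 + ε) * kbar q n⌋₊ with hM
    set K := ⌊ε * kbar q n⌋₊ with hK
    have hdle : (d : ℝ) ≤ 2 * n * q n + 2 * Real.log n := Nat.floor_le (by positivity)
    have hMle : (M : ℝ) ≤ (1 + ε) * kbar q n := Nat.floor_le (by positivity)
    have hKle : (K : ℝ) ≤ ε * kbar q n := Nat.floor_le (by positivity)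
    have hKge : ε * kbar q n < K + 1 := Nat.lt_floor_add_one _
    have hbound := hr (d + D) (M + K) (by push_cast; linarith) (by push_cast; linarith)
    set r := isolationBound (Real.sqrt (2 / (q n * (n : ℝ) ^ 2))) (d + D) (M + K) with hrdef
    have hr0 : 0 ≤ r := isolationBound_nonneg (Real.sqrt_nonneg _) hp1 _ _
    have hρ : (1 + η / 2) * (2 * max θ (1 - θ) * Real.log n) ≤ r * t n := by
      refine le_trans ?_ (mul_le_mul_of_nonneg_left (ht n) hr0)
      rw [div_le_iff₀ (by positivity)] at hbound
      have hm0 : 0 ≤ 2 * max θ (1 - θ) * Real.log n := by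
        have := hθ0.le.trans (le_max_left θ (1 - θ))
        positivity
      linarith [mul_le_mul_of_nonneg_right hbound hm0]
    refine (erTestsProb_ddDecoder_ne_le hq0 hq1 (Real.sqrt_nonneg _) hp1 hε0.le hε1
      (Nat.lt_floor_add_one _).le hD1 (Nat.le_floor hDk) hρ).trans ?_
    exact ddDecoder_failure_bound_le hn hc₁ hη hε0 hε1 (hq n).1 (hq n).2
      (Nat.lt_floor_add_one _).le hMle (by rw [← kbar]; linarith) hDη

end
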